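/- arXiv:1612.00675 — 10 statements merged into one kernel-verified Lean document; each statement's English description precedes it below -/
import Mathlib

section
/- Let n ≥ 1, let f be an n-ary Boolean function that is 0-separating of degree 2, and let k be a natural number with n ≤ 2k and k ≤ n. Then the number of assignments a : Fin n → Bool with f a = true and weight a = k is at least (n-1).choose (k-1). -/
/-- The weight of an assignment: the number of indices set to `true`. -/
def weight {n : ℕ} (a : Fin n → Bool) : ℕ :=
  (Finset.univ.filter fun i => a i = true).card

/-- If `f` is an `n`-ary Boolean function that is 0-separating of degree 2 and
`n / 2 ≤ k ≤ n`, then `f` has at least `(n-1).choose (k-1)` models of weight `k`. -/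
theorem models_of_weight_ge (n : ℕ) (hn : 1 ≤ n) (f : (Fin n → Bool) → Bool)
    (hsep : ∀ a b : Fin n → Bool, f a = false → f b = false →
      ∃ i, a i = false ∧ b i = false)
    (k : ℕ) (hk1 : n ≤ 2 * k) (hk2 : k ≤ n) :
    (n - 1).choose (k - 1) ≤
      (Finset.univ.filter fun a : Fin n → Bool => f a = true ∧ weight a = k).card := by
  classical
  set g : Finset (Fin n) → (Fin n → Bool) := fun s i => decide (i ∉ s) with hg
  have ginj : Function.Injective g := by
    intro s t h
    ext i
    have := congrFun h i
    simp only [hg, decide_eq_decide] at this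
    tauto
  have gw : ∀ s : Finset (Fin n), s.card = n - k → weight (g s) = k := by
    intro s hs
    have h1 : (Finset.univ.filter fun i => g s i = true) = sᶜ := by
      ext i
      simp [hg]
    rw [weight, h1, Finset.card_compl, hs, Fintype.card_fin]
    omega
  set P := Finset.powersetCard (n - k) (Finset.univ : Finset (Fin n)) with hP
  have hle : (P.filter fun s => f (g s) = true).card ≤
      (Finset.univ.filter fun a : Fin n → Bool => f a = true ∧ weight a = k).card := by
    apply Finset.card_le_card_of_injOn g
    · intro s hs
      have hs' := Finset.mem_filter.1 (Finset.mem_coe.1 hs)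
      have hc := (Finset.mem_powersetCard.1 hs'.1).2
      simpa using ⟨hs'.2, gw s hc⟩
    · exact ginj.injOn
  refine le_trans ?_ hle
  have hsum := Finset.card_filter_add_card_filter_not (s := P) (fun s => f (g s) = true)
  have hPc : P.card = n.choose (n - k) := by
    rw [hP, Finset.card_powersetCard, Finset.card_univ, Fintype.card_fin]
  have hint : ((P.filter fun s => ¬ f (g s) = true : Finset (Finset (Fin n))) :
      Set (Finset (Fin n))).Intersecting := by
    intro s hs t ht hd
    have hs' := (Finset.mem_filter.1 (Finset.mem_coe.1 hs)).2
    have ht' := (Finset.mem_filter.1 (Finset.mem_coe.1 ht)).2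
    obtain ⟨i, hi, hi'⟩ := hsep (g s) (g t) (by simpa using hs') (by simpa using ht')
    simp only [hg, decide_eq_false_iff_not, not_not] at hi hi'
    exact Finset.disjoint_left.1 hd hi hi'
  rw [Nat.choose_symm hk2] at hPc
  rcases Nat.lt_or_ge k n with h | h
  · have hE := Finset.erdos_ko_rado hint (r := n - k) (by
      intro s hs
      exact (Finset.mem_powersetCard.1 (Finset.mem_filter.1 (Finset.mem_coe.1 hs)).1).2) (by omega)
    obtain ⟨m, rfl⟩ : ∃ m, n = m + 1 := ⟨n - 1, by omega⟩
    obtain ⟨j, rfl⟩ : ∃ j, k = j + 1 := ⟨k - 1, by omega⟩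
    have e : m + 1 - (j + 1) - 1 = m - (j + 1) := by omega
    simp only [Nat.add_sub_cancel] at hE ⊢
    rw [e, Nat.choose_symm (by omega)] at hE
    rw [Nat.choose_succ_succ'] at hPc
    omega
  · obtain rfl : k = n := le_antisymm hk2 h
    rw [Nat.choose_self, Nat.one_le_iff_ne_zero, Finset.card_ne_zero]
    refine ⟨∅, Finset.mem_filter.2 ⟨by simp [hP], ?_⟩⟩
    by_contra hc
    obtain ⟨i, hi, -⟩ := hsep (g ∅) (g ∅) (by simpa using hc) (by simpa using hc)
    simp [hg] at hi
end

section
/- Let n ≥ 1, let f be an n-ary Boolean function that is 0-separating of degree 2, and let k be a natural number with n ≤ 2k and k < n. Then the number of assignments a : Fin n → Bool with f a = false and weight a = k is at most (n-1).choose (n-k-1). -/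
/-- If `f` is an `n`-ary Boolean function that is 0-separating of degree 2 and
`n / 2 ≤ k < n`, then `f` has at most `(n-1).choose (n-k-1)` non-models of weight `k`. -/
theorem nonmodels_of_weight_le (n : ℕ) (hn : 1 ≤ n) (f : (Fin n → Bool) → Bool)
    (hsep : ∀ a b : Fin n → Bool, f a = false → f b = false →
      ∃ i, a i = false ∧ b i = false)
    (k : ℕ) (hk1 : n ≤ 2 * k) (hk2 : k < n) :
    (Finset.univ.filter fun a : Fin n → Bool => f a = false ∧ weight a = k).card ≤
      (n - 1).choose (n - k - 1) := by
  classical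
  let g : (Fin n → Bool) → Finset (Fin n) := fun a => Finset.univ.filter fun i => a i = false
  have hg : Function.Injective g := by
    intro a b h
    funext i
    have h1 : i ∈ g a ↔ i ∈ g b := by rw [h]
    simp only [g, Finset.mem_filter, Finset.mem_univ, true_and] at h1
    cases ha : a i <;> cases hb : b i <;> simp_all
  rw [← Finset.card_image_of_injective _ hg]
  apply Finset.erdos_ko_rado
  · intro s hs t ht hd
    simp only [Finset.coe_image, Set.mem_image, Finset.mem_coe, Finset.mem_filter,
      Finset.mem_univ, true_and] at hs ht
    obtain ⟨a, ⟨ha, -⟩, rfl⟩ := hs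
    obtain ⟨b, ⟨hb, -⟩, rfl⟩ := ht
    obtain ⟨i, h1, h2⟩ := hsep a b ha hb
    exact (Finset.disjoint_left.mp hd : ∀ ⦃i⦄, i ∈ g a → i ∉ g b) (show i ∈ g a by simp [g, h1]) (by simp [g, h2])
  · intro s hs
    simp only [Finset.coe_image, Set.mem_image, Finset.mem_coe, Finset.mem_filter,
      Finset.mem_univ, true_and] at hs
    obtain ⟨a, ⟨-, ha⟩, rfl⟩ := hs
    have h := Finset.card_filter_add_card_filter_not (s := (Finset.univ : Finset (Fin n)))
      (fun i => a i = true)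
    simp only [Bool.not_eq_true, Finset.card_univ, Fintype.card_fin] at h
    unfold weight at ha
    show (Finset.univ.filter fun i => a i = false).card = n - k
    omega
  · omega
end

section
/- Let p > q ≥ 2 and d ≥ 0. If a : Fin (p^d) → Bool is an assignment whose weight is strictly less than q^d, then the complete t_q^p-tree of depth d evaluates to false on a. -/
/-- The `p`-ary `q`-threshold function: true iff at least `q` inputs are true. -/
def threshold (q p : ℕ) (a : Fin p → Bool) : Bool :=
  decide (q ≤ weight a)

/-- The complete `t_q^p`-tree of depth `d`. -/
def treeThreshold (q p : ℕ) : (d : ℕ) → (Fin (p ^ d) → Bool) → Bool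
  | 0, a => a ⟨0, by simp⟩
  | d + 1, a => threshold q p (fun j =>
      treeThreshold q p d (fun i => a ⟨j.val * p ^ d + i.val, by
        calc j.val * p ^ d + i.val < j.val * p ^ d + p ^ d :=
              Nat.add_lt_add_left i.isLt _
          _ = (j.val + 1) * p ^ d := by ring
          _ ≤ p * p ^ d := Nat.mul_le_mul_right _ j.isLt
          _ = p ^ (d + 1) := by rw [pow_succ]; ring⟩))

theorem block_sum_le (p P N : ℕ) (a : Fin N → Bool)
    (h : ∀ (j : Fin p) (i : Fin P), j.val * P + i.val < N) :
    ∑ j : Fin p, weight (fun i : Fin P => a ⟨j.val * P + i.val, h j i⟩) ≤ weight a := by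
  unfold weight
  rw [← Finset.card_sigma]
  apply Finset.card_le_card_of_injOn (fun x => (⟨x.1.val * P + x.2.val, h x.1 x.2⟩ : Fin N))
  · intro x hx
    simpa using hx
  · rintro ⟨j, i⟩ _ ⟨j', i'⟩ _ hxy
    have e : j.val * P + i.val = j'.val * P + i'.val := by simpa using hxy
    have hP : 0 < P := lt_of_le_of_lt (Nat.zero_le _) i.isLt
    have hj : j.val = j'.val := by
      have := congrArg (· / P) e
      simpa [mul_comm _ P, Nat.mul_add_div hP, Nat.div_eq_of_lt i.isLt,
        Nat.div_eq_of_lt i'.isLt] using this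
    have hi : i.val = i'.val := by rw [hj] at e; omega
    obtain rfl := Fin.ext hj
    obtain rfl := Fin.ext hi
    rfl

theorem le_weight_of_tree (p q d : ℕ) : ∀ (a : Fin (p ^ d) → Bool),
    treeThreshold q p d a = true → q ^ d ≤ weight a := by
  induction d with
  | zero =>
    intro a h
    simp only [treeThreshold] at h
    rw [pow_zero, weight, Nat.one_le_iff_ne_zero]
    exact Finset.card_ne_zero_of_mem (Finset.mem_filter.2 ⟨Finset.mem_univ _, h⟩)
  | succ d ih =>
    intro a h
    simp only [treeThreshold, threshold, decide_eq_true_eq] at h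
    have hb : ∀ (j : Fin p) (i : Fin (p ^ d)), j.val * p ^ d + i.val < p ^ (d + 1) := by
      intro j i
      have h1 := Nat.mul_le_mul_right (p ^ d) (Nat.succ_le_of_lt j.isLt)
      have h2 := i.isLt
      rw [Nat.succ_mul] at h1
      rw [pow_succ, mul_comm (p ^ d) p]
      omega
    refine le_trans ?_ (block_sum_le p (p ^ d) (p ^ (d + 1)) a hb)
    rw [weight] at h
    set S := Finset.univ.filter (fun j : Fin p =>
      treeThreshold q p d (fun i => a ⟨j.val * p ^ d + i.val, hb j i⟩) = true) with hS
    refine le_trans ?_ (Finset.sum_le_sum_of_subset (Finset.subset_univ S))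
    refine le_trans ?_ (Finset.card_nsmul_le_sum S _ (q ^ d) ?_)
    · rw [smul_eq_mul, pow_succ, mul_comm]
      exact Nat.mul_le_mul_right _ h
    · intro j hj
      exact ih _ (Finset.mem_filter.1 hj).2

/-- The complete `t_q^p`-tree of depth `d` evaluates to false on every
assignment of weight strictly less than `q ^ d`. -/
theorem treeThreshold_eq_false (p q : ℕ) (hq : 2 ≤ q) (hpq : q < p) (d : ℕ)
    (a : Fin (p ^ d) → Bool) (ha : weight a < q ^ d) :
    treeThreshold q p d a = false := by
  by_contra h
  have := le_weight_of_tree p q d a (by simpa using h)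
  omega
end

section
/- Let q ≥ 2, p ≥ 2q - 1 and d ≥ 0. If a : Fin (p^d) → Bool is an assignment in which strictly fewer than q^d coordinates are false (equivalently, whose weight is strictly greater than p^d - q^d), then the complete t_q^p-tree of depth d evaluates to true on a. -/
/-- If strictly fewer than `q ^ d` coordinates of `a` are false, then the
complete `t_q^p`-tree of depth `d` evaluates to true on `a`. -/
theorem treeThreshold_eq_true (p q : ℕ) (hq : 2 ≤ q) (hp : 2 * q - 1 ≤ p) (d : ℕ)
    (a : Fin (p ^ d) → Bool)
    (ha : (Finset.univ.filter fun i => a i = false).card < q ^ d) :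
    treeThreshold q p d a = true := by
  induction d with
  | zero =>
    by_contra h
    have h' : a ⟨0, by simp⟩ = false := by
      simpa [treeThreshold] using h
    have : 0 < (Finset.univ.filter fun i => a i = false).card :=
      Finset.card_pos.mpr ⟨⟨0, by simp⟩, Finset.mem_filter.mpr ⟨Finset.mem_univ _, h'⟩⟩
    simp only [pow_zero] at ha this
    omega
  | succ d ih =>
    rw [treeThreshold, threshold, decide_eq_true_eq, weight]
    have hlt : ∀ (j : Fin p) (i : Fin (p ^ d)), j.val * p ^ d + i.val < p ^ (d + 1) := by
      intro j i
      calc j.val * p ^ d + i.val < j.val * p ^ d + p ^ d :=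
              Nat.add_lt_add_left i.isLt _
          _ = (j.val + 1) * p ^ d := by ring
          _ ≤ p * p ^ d := Nat.mul_le_mul_right _ j.isLt
          _ = p ^ (d + 1) := by rw [pow_succ]; ring
    set b : Fin p → Fin (p ^ d) → Bool := fun j i => a ⟨j.val * p ^ d + i.val, hlt j i⟩ with hb
    change q ≤ (Finset.univ.filter fun j => treeThreshold q p d (b j) = true).card
    have hsplit := Finset.card_filter_add_card_filter_not (s := (Finset.univ : Finset (Fin p)))
      (fun j => treeThreshold q p d (b j) = true)
    rw [Finset.card_univ, Fintype.card_fin] at hsplit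
    set F := Finset.univ.filter fun j => ¬ treeThreshold q p d (b j) = true with hF
    have h1 : F.card * q ^ d ≤
        ∑ j ∈ F, (Finset.univ.filter fun i => b j i = false).card := by
      rw [← smul_eq_mul]
      apply Finset.card_nsmul_le_sum
      intro j hj
      by_contra hc
      exact (Finset.mem_filter.mp hj).2 (ih (b j) (not_le.mp hc))
    have h2 : ∑ j ∈ F, (Finset.univ.filter fun i => b j i = false).card ≤
        (Finset.univ.filter fun i => a i = false).card := by
      rw [← Finset.card_sigma]
      apply Finset.card_le_card_of_injOn (fun x => ⟨x.1.val * p ^ d + x.2.val, hlt x.1 x.2⟩)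
      · intro x hx
        have := (Finset.mem_sigma.mp hx).2
        simpa [hb] using this
      · rintro ⟨j, i⟩ _ ⟨j', i'⟩ _ h
        have h : j.val * p ^ d + i.val = j'.val * p ^ d + i'.val := congrArg Fin.val h
        have hpos : 0 < p ^ d := i.pos
        have hj : j = j' := by
          have := congrArg (· / p ^ d) h
          simp only [mul_comm _ (p ^ d), Nat.mul_add_div hpos, Nat.div_eq_of_lt i.isLt,
            Nat.div_eq_of_lt i'.isLt] at this
          exact Fin.ext (by simpa using this)
        subst hj
        have hi : i = i' := Fin.ext (by omega)
        subst hi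
        rfl
    have h3 : F.card < q := by
      have : F.card * q ^ d < q * q ^ d := by
        rw [← pow_succ']
        omega
      exact lt_of_mul_lt_mul_right this (Nat.zero_le _)
    omega
end

section
/- Let n and k be natural numbers with k² < n, and set t = Real.sqrt ((n : ℝ) - k + 1/4) - (k : ℝ) + 1/2. Then (k : ℝ) + ⌊t⌋₊ ≤ Real.sqrt ((n : ℝ) + ⌊t⌋₊), where ⌊t⌋₊ denotes the natural-number floor of t. -/
/-- For natural numbers `n`, `k` with `k² < n` and
`t = √(n - k + 1/4) - k + 1/2`, one has `k + ⌊t⌋₊ ≤ √(n + ⌊t⌋₊)`. -/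
theorem add_floor_le_sqrt (n k : ℕ) (h : k ^ 2 < n)
    (t : ℝ) (ht : t = Real.sqrt ((n : ℝ) - k + 1/4) - (k : ℝ) + 1/2) :
    (k : ℝ) + (⌊t⌋₊ : ℝ) ≤ Real.sqrt ((n : ℝ) + (⌊t⌋₊ : ℝ)) := by
  have hR : (k : ℝ) ^ 2 < n := by exact_mod_cast h
  have hk : (0 : ℝ) ≤ k := Nat.cast_nonneg k
  apply Real.le_sqrt_of_sq_le
  rcases Nat.eq_zero_or_pos ⌊t⌋₊ with h0 | hpos
  · rw [h0]
    simpa using hR.le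
  · have hle : (⌊t⌋₊ : ℝ) ≤ t := Nat.floor_le (Nat.pos_of_floor_pos hpos).le
    have h1 : (1 : ℝ) ≤ (⌊t⌋₊ : ℝ) := by exact_mod_cast hpos
    have hs : 0 ≤ (n : ℝ) - k + 1/4 := by nlinarith [sq_nonneg ((k : ℝ) - 1/2)]
    have hsq := Real.sq_sqrt hs
    have h2 : (k : ℝ) + ⌊t⌋₊ - 1/2 ≤ Real.sqrt ((n : ℝ) - k + 1/4) := by linarith
    have h3 := pow_le_pow_left₀ (by linarith) h2 2
    rw [hsq] at h3
    nlinarith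
end

section
/- Let n and k be natural numbers with k² < n, and set t = Real.sqrt ((n : ℝ) - k + 1/4) - (k : ℝ) + 1/2. Then Real.sqrt ((n : ℝ) + ⌊t⌋₊) < (k : ℝ) + ⌊t⌋₊ + 1, where ⌊t⌋₊ denotes the natural-number floor of t. -/
/-- For natural numbers `n`, `k` with `k² < n` and
`t = √(n - k + 1/4) - k + 1/2`, one has `√(n + ⌊t⌋₊) < k + ⌊t⌋₊ + 1`. -/
theorem sqrt_lt_add_floor_add_one (n k : ℕ) (h : k ^ 2 < n)
    (t : ℝ) (ht : t = Real.sqrt ((n : ℝ) - k + 1/4) - (k : ℝ) + 1/2) :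
    Real.sqrt ((n : ℝ) + (⌊t⌋₊ : ℝ)) < (k : ℝ) + (⌊t⌋₊ : ℝ) + 1 := by
  have h1 := Nat.lt_floor_add_one t
  have hm : (0 : ℝ) ≤ (⌊t⌋₊ : ℝ) := Nat.cast_nonneg _
  have hk : (0 : ℝ) ≤ (k : ℝ) := Nat.cast_nonneg _
  generalize (⌊t⌋₊ : ℝ) = m at *
  have h2 : Real.sqrt ((n : ℝ) - k + 1/4) < k + m + 1/2 := by linarith
  rw [Real.sqrt_lt' (by linarith)] at h2
  rw [Real.sqrt_lt' (by linarith)]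
  nlinarith
end

section
/- Let n ≥ 1, let g : (Fin n → Bool) → Bool, and let G : (Fin n → Bool) → Bool → Bool satisfy G x false = g x for all x. Define h : (Fin n → Bool) → Bool → Bool → Bool by h x f t = (G x f) && t && (!f || decide (∀ i, x i = true)). Then g has a model if and only if h has a non-trivial model, i.e., (∃ x, g x = true) ↔ (∃ x f t, h x f t = true ∧ ¬(∀ i, x i = false ∧ f = false ∧ t = false) ∧ ¬(∀ i, x i = true ∧ f = true ∧ t = true)). -/
/-- Semantic correctness of the reduction for SAT*(B): `g` has a model iff
`h x f t = (G x f) && t && (!f || ⋀ i, x i)` has a non-trivial model. -/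
theorem sat_iff_nontrivial_sat (n : ℕ) (hn : 1 ≤ n)
    (g : (Fin n → Bool) → Bool)
    (G : (Fin n → Bool) → Bool → Bool) (hG : ∀ x, G x false = g x)
    (h : (Fin n → Bool) → Bool → Bool → Bool)
    (hh : ∀ x f t, h x f t = ((G x f) && t && (!f || decide (∀ i, x i = true)))) :
    (∃ x, g x = true) ↔
      (∃ x f t, h x f t = true ∧
        ¬(∀ i, x i = false ∧ f = false ∧ t = false) ∧
        ¬(∀ i, x i = true ∧ f = true ∧ t = true)) := by
  constructor
  · rintro ⟨x, hx⟩
    refine ⟨x, false, true, ?_, ?_, ?_⟩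
    · rw [hh, hG, hx]; rfl
    · intro H
      have := (H ⟨0, hn⟩).2.2
      cases this
    · intro H
      have := (H ⟨0, hn⟩).2.1
      cases this
  · rintro ⟨x, f, t, h1, -, h3⟩
    rw [hh, Bool.and_eq_true, Bool.and_eq_true] at h1
    obtain ⟨⟨hg, ht⟩, hf⟩ := h1
    cases f with
    | false => exact ⟨x, by rw [← hG]; exact hg⟩
    | true =>
      exfalso
      apply h3
      have hx : ∀ i, x i = true := by simpa using hf
      exact fun i => ⟨hx i, rfl, ht⟩
end

section
/- Let n, m, k be natural numbers, let g : (Fin n → Bool) → Bool, let G : (Fin n → Bool) → Bool → Bool satisfy G x false = g x for all x, and let F : (Fin m → Bool) → Bool satisfy F y = false for every y of weight at most n. Then g has a model of weight at most k if and only if the Boolean function (x, y) ↦ G x (F y) on n + m variables has a model of total weight at most min n k, i.e., (∃ x, g x = true ∧ weight x ≤ k) ↔ (∃ x y, G x (F y) = true ∧ weight x + weight y ≤ min n k). -/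
/-- Semantic correctness of the reduction MINONES(B ∪ {false}) ≤ MINONES(B):
replacing the constant false with a function `F` on fresh variables that is
false on all assignments of weight at most `n`. -/
theorem minOnes_false_reduction (n m k : ℕ)
    (g : (Fin n → Bool) → Bool)
    (G : (Fin n → Bool) → Bool → Bool) (hG : ∀ x, G x false = g x)
    (F : (Fin m → Bool) → Bool) (hF : ∀ y, weight y ≤ n → F y = false) :
    (∃ x, g x = true ∧ weight x ≤ k) ↔
      (∃ x y, G x (F y) = true ∧ weight x + weight y ≤ min n k) := by
  have h0 : weight (fun _ : Fin m => false) = 0 := by simp [weight]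
  constructor
  · rintro ⟨x, hx, hk⟩
    have hn : weight x ≤ n := by
      unfold weight
      exact (Finset.card_le_univ _).trans (by simp)
    refine ⟨x, fun _ => false, ?_, ?_⟩
    · rw [hF _ (by rw [h0]; exact Nat.zero_le n), hG]
      exact hx
    · rw [h0]
      exact le_min hn hk
  · rintro ⟨x, y, h, hw⟩
    have h1 := le_min_iff.mp hw
    refine ⟨x, ?_, by omega⟩
    rw [hF y (by omega), hG] at h
    exact h
end

section
/- Let n, k be natural numbers, let g : (Fin n → Bool) → Bool, and let G : (Fin n → Bool) → Bool → Bool satisfy G x false = g x for all x. Assign weight 1 to each of the n variables and weight n + 1 to the fresh variable f. Then g has a model of weight at most k if and only if the Boolean function (x, f) ↦ G x f has a model of weighted total at most min n k, i.e., (∃ x, g x = true ∧ weight x ≤ k) ↔ (∃ x f, G x f = true ∧ weight x + (if f then n + 1 else 0) ≤ min n k). -/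
/-- Semantic correctness of the reduction for wMINONES(B): replacing the
constant false with a fresh variable `f` of weight `n + 1`. -/
theorem wMinOnes_reduction (n k : ℕ)
    (g : (Fin n → Bool) → Bool)
    (G : (Fin n → Bool) → Bool → Bool) (hG : ∀ x, G x false = g x) :
    (∃ x, g x = true ∧ weight x ≤ k) ↔
      (∃ x f, G x f = true ∧ weight x + (if f then n + 1 else 0) ≤ min n k) := by
  constructor
  · rintro ⟨x, hx, hw⟩
    have hn : weight x ≤ n := by
      unfold weight
      exact (Finset.card_le_univ _).trans (by simp)
    exact ⟨x, false, by rw [hG, hx], by simpa using ⟨hn, hw⟩⟩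
  · rintro ⟨x, f, hf, hw⟩
    have h1 := hw.trans (min_le_left n k)
    have h2 := hw.trans (min_le_right n k)
    cases f with
    | false => exact ⟨x, by rw [← hG, hf], by simpa using h2⟩
    | true =>
      simp only [if_true] at h1
      omega
end

section
/- Let n ≥ 1, let g : (Fin n → Bool) → Bool, and let G : (Fin n → Bool) → Bool → Bool satisfy G x false = g x for all x. Define H : (Fin n → Bool) → Bool → Bool by H x f = (G x f) && (!f || decide (∀ i, x i = true)). Then g has a model of weight at least ⌈(n : ℝ) - Real.sqrt n⌉ if and only if H has a model of total weight v with ⌈(n : ℝ) - Real.sqrt n⌉ ≤ v and v < n + 1, i.e., (∃ x, g x = true ∧ (⌈(n : ℝ) - Real.sqrt n⌉ : ℤ) ≤ weight x) ↔ (∃ x f, H x f = true ∧ (⌈(n : ℝ) - Real.sqrt n⌉ : ℤ) ≤ weight x + (if f then 1 else 0) ∧ weight x + (if f then 1 else 0) < n + 1). -/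
/-- Semantic core of the reduction from invRootWSAT to MAXONES*(B): `g` has a
model of weight at least `⌈n - √n⌉` iff `H x f = (G x f) && (!f || ⋀ i, x i)`
has a model of total weight `v` with `⌈n - √n⌉ ≤ v < n + 1`. -/
theorem maxOnesStar_reduction (n : ℕ) (hn : 1 ≤ n)
    (g : (Fin n → Bool) → Bool)
    (G : (Fin n → Bool) → Bool → Bool) (hG : ∀ x, G x false = g x)
    (H : (Fin n → Bool) → Bool → Bool)
    (hH : ∀ x f, H x f = ((G x f) && (!f || decide (∀ i, x i = true)))) :
    (∃ x, g x = true ∧ (⌈(n : ℝ) - Real.sqrt n⌉ : ℤ) ≤ (weight x : ℤ)) ↔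
      (∃ x f, H x f = true ∧
        (⌈(n : ℝ) - Real.sqrt n⌉ : ℤ) ≤ (weight x : ℤ) + (if f then 1 else 0) ∧
        (weight x : ℤ) + (if f then 1 else 0) < (n : ℤ) + 1) := by
  constructor
  · rintro ⟨x, hx, hw⟩
    have hle : weight x ≤ n := by
      have := Finset.card_filter_le (Finset.univ : Finset (Fin n)) (fun i => x i = true)
      simpa [weight] using this
    refine ⟨x, false, ?_, ?_, ?_⟩
    · simp [hH, hG, hx]
    · simpa using hw
    · simp only [Bool.false_eq_true, if_false]
      omega
  · rintro ⟨x, f, hx, h1, h2⟩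
    rw [hH] at hx
    cases f with
    | false =>
      refine ⟨x, ?_, by simpa using h1⟩
      simpa [hG] using hx
    | true =>
      exfalso
      simp at hx
      have : weight x = n := by simp [weight, hx.2]
      simp [this] at h2
end
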